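/- Let f : 2^{[k]} → ℝ be submodular, increasing, and normalized. Then the Lovász hinge embeds the structured abstain loss ℓ_abs^f: for every probability distribution p on Y = {−1,1}^k and every v ∈ V = {−1,0,1}^k, v minimizes ℓ_abs^f(·; p) over V if and only if v minimizes L^f(·; p) over all of ℝ^k; that is, ℓ_abs^f(v; p) ≤ ℓ_abs^f(v'; p) for all v' ∈ V holds if and only if L^f(v; p) ≤ L^f(u; p) for all u ∈ ℝ^k. -/

import Mathlib

open Finset

noncomputable section

/-- The set {π(1),…,π(i)} of the first `i` elements under permutation `π`. -/
def Spi (k : ℕ) (π : Equiv.Perm (Fin k)) (i : ℕ) : Finset (Fin k) :=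
  (Finset.univ.filter (fun m : Fin k => (m : ℕ) < i)).image π

/-- The Lovász extension of a set function `f`. -/
def lovaszExt (k : ℕ) (f : Finset (Fin k) → ℝ) (x : Fin k → ℝ) : ℝ :=
  Finset.univ.sup' Finset.univ_nonempty
    (fun π : Equiv.Perm (Fin k) =>
      ∑ i : Fin k, x (π i) * (f (Spi k π ((i : ℕ) + 1)) - f (Spi k π (i : ℕ))))

/-- The Lovász hinge `L^f(u,y) = F((𝟙 - u ⊙ y)₊)`. -/
def lovaszHinge (k : ℕ) (f : Finset (Fin k) → ℝ) (u y : Fin k → ℝ) : ℝ :=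
  lovaszExt k f (fun i => max (1 - u i * y i) 0)

/-- The `±1` vector associated with a Boolean vector, indexing the outcome space `Y = {-1,1}^k`. -/
def ytov (k : ℕ) (b : Fin k → Bool) : Fin k → ℝ := fun i => if b i then 1 else -1

/-- `p` is a probability distribution on `Y = {-1,1}^k`. -/
def IsProb (k : ℕ) (p : (Fin k → ℝ) → ℝ) : Prop :=
  (∀ b : Fin k → Bool, 0 ≤ p (ytov k b)) ∧ ∑ b : Fin k → Bool, p (ytov k b) = 1

/-- Expected Lovász hinge loss `L^f(u; p)`. -/
def expLossL (k : ℕ) (f : Finset (Fin k) → ℝ) (u : Fin k → ℝ) (p : (Fin k → ℝ) → ℝ) : ℝ :=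
  ∑ b : Fin k → Bool, p (ytov k b) * lovaszHinge k f u (ytov k b)

/-- The structured abstain loss `ℓ_abs^f`. -/
def labs (k : ℕ) (f : Finset (Fin k) → ℝ) (v y : Fin k → ℝ) : ℝ :=
  f (Finset.univ.filter (fun i => v i * y i < 0)) +
    f (Finset.univ.filter (fun i => v i * y i ≤ 0))

/-- Expected structured abstain loss `ℓ_abs^f(v; p)`. -/
def expLossAbs (k : ℕ) (f : Finset (Fin k) → ℝ) (v : Fin k → ℝ) (p : (Fin k → ℝ) → ℝ) : ℝ :=
  ∑ b : Fin k → Bool, p (ytov k b) * labs k f v (ytov k b)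

/-- The linear functional of the Lovász extension attached to the permutation `π`. -/
def lovaszSum (k : ℕ) (f : Finset (Fin k) → ℝ) (π : Equiv.Perm (Fin k)) (x : Fin k → ℝ) : ℝ :=
  ∑ i : Fin k, x (π i) * (f (Spi k π ((i : ℕ) + 1)) - f (Spi k π (i : ℕ)))

/-- The odd threshold function: the sign of `z` when `t < |z|`, and `0` otherwise (for `0 ≤ t`). -/
def signThreshold (t z : ℝ) : ℝ := (if t < z then 1 else 0) - (if t < -z then 1 else 0)

theorem mem_Spi {k : ℕ} (π : Equiv.Perm (Fin k)) (n : ℕ) (i : Fin k) :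
    π i ∈ Spi k π n ↔ (i : ℕ) < n := by
  simp [Spi]

theorem Spi_zero {k : ℕ} (π : Equiv.Perm (Fin k)) : Spi k π 0 = ∅ := by
  simp [Spi]

theorem Spi_card {k : ℕ} (π : Equiv.Perm (Fin k)) : Spi k π k = univ := by
  ext j
  obtain ⟨i, rfl⟩ := π.surjective j
  simp [mem_Spi]

theorem Spi_succ {k : ℕ} (π : Equiv.Perm (Fin k)) (i : Fin k) :
    Spi k π ((i : ℕ) + 1) = insert (π i) (Spi k π i) := by
  ext j
  obtain ⟨j, rfl⟩ := π.surjective j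
  rw [mem_insert, mem_Spi, mem_Spi, π.injective.eq_iff, Fin.ext_iff]
  omega

theorem Spi_inter_sum {k : ℕ} {f : Finset (Fin k) → ℝ} (hnorm : f ∅ = 0)
    (π : Equiv.Perm (Fin k)) (A : Finset (Fin k)) :
    ∑ i : Fin k, (f (A ∩ Spi k π ((i : ℕ) + 1)) - f (A ∩ Spi k π (i : ℕ))) = f A := by
  rw [Fin.sum_univ_eq_sum_range (fun i => f (A ∩ Spi k π (i + 1)) - f (A ∩ Spi k π i)) k,
    Finset.sum_range_sub (fun i => f (A ∩ Spi k π i)), Spi_card, Spi_zero]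
  simp [hnorm]

theorem lovaszSum_indicator_le {k : ℕ} {f : Finset (Fin k) → ℝ}
    (hsub : ∀ S T : Finset (Fin k), f (S ∪ T) + f (S ∩ T) ≤ f S + f T) (hnorm : f ∅ = 0)
    (π : Equiv.Perm (Fin k)) (A : Finset (Fin k)) :
    lovaszSum k f π (fun i => if i ∈ A then 1 else 0) ≤ f A := by
  rw [← Spi_inter_sum hnorm π A]
  refine Finset.sum_le_sum fun i _ => ?_
  rw [Spi_succ]
  by_cases h : π i ∈ A
  · have h1 := hsub (A ∩ insert (π i) (Spi k π i)) (Spi k π i)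
    have h2 : A ∩ insert (π i) (Spi k π i) ∪ Spi k π i = insert (π i) (Spi k π i) := by
      ext j
      simp only [mem_union, mem_inter, mem_insert]
      grind
    have h3 : A ∩ insert (π i) (Spi k π i) ∩ Spi k π i = A ∩ Spi k π i := by
      ext j
      simp only [mem_inter, mem_insert]
      tauto
    rw [h2, h3] at h1
    simp only [h, if_true]
    linarith
  · simp [h, Finset.inter_insert_of_notMem]

theorem lovaszSum_indicator_eq {k : ℕ} {f : Finset (Fin k) → ℝ} (hnorm : f ∅ = 0)
    (π : Equiv.Perm (Fin k)) (A : Finset (Fin k)) (hA : ∀ i j, i ≤ j → π j ∈ A → π i ∈ A) :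
    lovaszSum k f π (fun i => if i ∈ A then 1 else 0) = f A := by
  rw [← Spi_inter_sum hnorm π A]
  refine Finset.sum_congr rfl fun i _ => ?_
  by_cases h : π i ∈ A
  · have hs : Spi k π ((i : ℕ) + 1) ⊆ A := by
      intro j hj
      obtain ⟨j, rfl⟩ := π.surjective j
      rw [mem_Spi] at hj
      exact hA j i (Fin.le_def.2 (by omega)) h
    have hs' : Spi k π (i : ℕ) ⊆ A := by
      rw [Spi_succ] at hs
      exact (Finset.subset_insert _ _).trans hs
    rw [Finset.inter_eq_right.2 hs, Finset.inter_eq_right.2 hs']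
    simp [h]
  · rw [Spi_succ]
    simp [h, Finset.inter_insert_of_notMem]

theorem lovaszSum_add {k : ℕ} (f : Finset (Fin k) → ℝ) (π : Equiv.Perm (Fin k))
    (x y : Fin k → ℝ) :
    lovaszSum k f π (fun i => x i + y i) = lovaszSum k f π x + lovaszSum k f π y := by
  simp only [lovaszSum, add_mul, Finset.sum_add_distrib]

theorem lovaszSum_mono {k : ℕ} {f : Finset (Fin k) → ℝ}
    (hinc : ∀ S T : Finset (Fin k), Disjoint S T → f S ≤ f (S ∪ T)) (π : Equiv.Perm (Fin k))
    {x y : Fin k → ℝ} (h : ∀ i, x i ≤ y i) : lovaszSum k f π x ≤ lovaszSum k f π y := by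
  refine Finset.sum_le_sum fun i _ => mul_le_mul_of_nonneg_right (h _) ?_
  have hd : Disjoint (Spi k π i) {π i} := by
    rw [Finset.disjoint_singleton_right, mem_Spi]
    omega
  have := hinc _ _ hd
  rw [Spi_succ, Finset.insert_eq, Finset.union_comm]
  linarith

theorem lovaszSum_le_lovaszExt {k : ℕ} (f : Finset (Fin k) → ℝ) (π : Equiv.Perm (Fin k))
    (x : Fin k → ℝ) : lovaszSum k f π x ≤ lovaszExt k f x :=
  Finset.le_sup' (fun π => lovaszSum k f π x) (Finset.mem_univ π)

theorem one_sub_eq_indicator_add {k : ℕ} {z : Fin k → ℝ}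
    (hz : ∀ i, z i = -1 ∨ z i = 0 ∨ z i = 1) :
    (fun i => 1 - z i) = fun i =>
      (if i ∈ univ.filter (fun i => z i < 0) then (1 : ℝ) else 0) +
        (if i ∈ univ.filter (fun i => z i ≤ 0) then 1 else 0) := by
  funext i
  rcases hz i with h | h | h <;> norm_num [h]

theorem mul_ytov_mem {k : ℕ} {v : Fin k → ℝ} (hv : ∀ i, v i = -1 ∨ v i = 0 ∨ v i = 1)
    (b : Fin k → Bool) (i : Fin k) :
    v i * ytov k b i = -1 ∨ v i * ytov k b i = 0 ∨ v i * ytov k b i = 1 := by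
  unfold ytov
  rcases hv i with h | h | h <;> split_ifs <;> norm_num [h]

theorem lovaszHinge_le_labs {k : ℕ} {f : Finset (Fin k) → ℝ}
    (hsub : ∀ S T : Finset (Fin k), f (S ∪ T) + f (S ∩ T) ≤ f S + f T) (hnorm : f ∅ = 0)
    {v : Fin k → ℝ} (hv : ∀ i, v i = -1 ∨ v i = 0 ∨ v i = 1) (b : Fin k → Bool) :
    lovaszHinge k f v (ytov k b) ≤ labs k f v (ytov k b) := by
  have hz := mul_ytov_mem hv b
  have hmax : (fun i => max (1 - v i * ytov k b i) 0) = fun i => 1 - v i * ytov k b i := by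
    funext i
    rcases hz i with h | h | h <;> norm_num [h]
  rw [lovaszHinge, hmax, one_sub_eq_indicator_add hz]
  refine Finset.sup'_le _ _ fun π _ => ?_
  exact (lovaszSum_add f π _ _).trans_le <| add_le_add (lovaszSum_indicator_le hsub hnorm π _)
    (lovaszSum_indicator_le hsub hnorm π _)

theorem lovaszSum_one_sub_eq_labs {k : ℕ} {f : Finset (Fin k) → ℝ} (hnorm : f ∅ = 0)
    {v : Fin k → ℝ} (hv : ∀ i, v i = -1 ∨ v i = 0 ∨ v i = 1) (b : Fin k → Bool)
    (π : Equiv.Perm (Fin k)) (hπ : Monotone fun i => v (π i) * ytov k b (π i)) :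
    lovaszSum k f π (fun i => 1 - v i * ytov k b i) = labs k f v (ytov k b) := by
  rw [one_sub_eq_indicator_add (mul_ytov_mem hv b), lovaszSum_add, labs,
    lovaszSum_indicator_eq hnorm, lovaszSum_indicator_eq hnorm]
  · intro i j hij
    simp only [mem_filter, mem_univ, true_and]
    exact (hπ hij).trans
  · intro i j hij
    simp only [mem_filter, mem_univ, true_and]
    exact (hπ hij).trans_lt

theorem signThreshold_mem (t z : ℝ) :
    signThreshold t z = -1 ∨ signThreshold t z = 0 ∨ signThreshold t z = 1 := by
  unfold signThreshold
  split_ifs <;> norm_num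

theorem signThreshold_mono (t : ℝ) : Monotone (signThreshold t) := by
  intro x y h
  unfold signThreshold
  split_ifs <;> linarith

theorem signThreshold_mul_ytov {k : ℕ} (t z : ℝ) (b : Fin k → Bool) (i : Fin k) :
    signThreshold t z * ytov k b i = signThreshold t (z * ytov k b i) := by
  cases h : b i <;> simp [ytov, signThreshold, h]

open MeasureTheory in
theorem integral_Ioc_threshold {z : ℝ} (hz : z ≤ 1) :
    IntegrableOn (fun t : ℝ => if t < z then (1 : ℝ) else 0) (Set.Ioc 0 1) ∧
      ∫ t in Set.Ioc (0 : ℝ) 1, (if t < z then (1 : ℝ) else 0) = max z 0 := by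
  have he : (fun t : ℝ => if t < z then (1 : ℝ) else 0) = (Set.Iio z).indicator fun _ => 1 := by
    funext t
    simp [Set.indicator_apply]
  have hs : Set.Ioc (0 : ℝ) 1 ∩ Set.Iio z = Set.Ioo 0 z := by
    ext t
    simp only [Set.mem_inter_iff, Set.mem_Ioc, Set.mem_Iio, Set.mem_Ioo]
    constructor
    · exact fun h => ⟨h.1.1, h.2⟩
    · exact fun h => ⟨⟨h.1, h.2.le.trans hz⟩, h.2⟩
  rw [he]
  constructor
  · exact (integrable_const _).indicator measurableSet_Iio
  · rw [setIntegral_indicator measurableSet_Iio, hs]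
    simp [Measure.real, ENNReal.toReal_ofReal', Real.volume_Ioo]

open MeasureTheory in
theorem integral_Ioc_signThreshold {z : ℝ} (hz : -1 ≤ z) (hz' : z ≤ 1) :
    IntegrableOn (fun t : ℝ => signThreshold t z) (Set.Ioc 0 1) ∧
      ∫ t in Set.Ioc (0 : ℝ) 1, signThreshold t z = z := by
  obtain ⟨h1, h2⟩ := integral_Ioc_threshold hz'
  obtain ⟨h3, h4⟩ := integral_Ioc_threshold (z := -z) (by linarith)
  refine ⟨h1.sub h3, ?_⟩
  unfold signThreshold
  rw [integral_sub h1 h3, h2, h4]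
  rcases le_total z 0 with h | h
  · rw [max_eq_right h, max_eq_left (by linarith)]
    ring
  · rw [max_eq_left h, max_eq_right (by linarith)]
    ring

open MeasureTheory in
/-- A point of the cube is an average of its thresholdings, so a linear functional does not
exceed its value at the point on one of them. -/
theorem exists_sum_signThreshold_le {ι : Type*} (s : Finset ι) (a z : ι → ℝ)
    (hz : ∀ i, -1 ≤ z i) (hz' : ∀ i, z i ≤ 1) :
    ∃ t : ℝ, ∑ i ∈ s, a i * signThreshold t (z i) ≤ ∑ i ∈ s, a i * z i := by
  have hi : ∀ i ∈ s, IntegrableOn (fun t : ℝ => a i * signThreshold t (z i)) (Set.Ioc 0 1) :=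
    fun i _ => (integral_Ioc_signThreshold (hz i) (hz' i)).1.const_mul _
  have : IsProbabilityMeasure (volume.restrict (Set.Ioc (0 : ℝ) 1)) := ⟨by simp⟩
  obtain ⟨t, ht⟩ := exists_le_integral (integrable_finsetSum s hi)
  refine ⟨t, ht.trans_eq ?_⟩
  rw [integral_finsetSum s hi]
  refine Finset.sum_congr rfl fun i _ => ?_
  rw [integral_const_mul, (integral_Ioc_signThreshold (hz i) (hz' i)).2]

theorem exists_expLossAbs_le_expLossL {k : ℕ} {f : Finset (Fin k) → ℝ}
    (hinc : ∀ S T : Finset (Fin k), Disjoint S T → f S ≤ f (S ∪ T)) (hnorm : f ∅ = 0)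
    {p : (Fin k → ℝ) → ℝ} (hp : ∀ b : Fin k → Bool, 0 ≤ p (ytov k b)) (u : Fin k → ℝ) :
    ∃ v : Fin k → ℝ, (∀ i, v i = -1 ∨ v i = 0 ∨ v i = 1) ∧
      expLossAbs k f v p ≤ expLossL k f u p := by
  set w : Fin k → ℝ := fun i => max (-1) (min 1 (u i)) with hw
  have hw1 : ∀ i, -1 ≤ w i := fun i => le_max_left _ _
  have hw2 : ∀ i, w i ≤ 1 := fun i => max_le (by norm_num) (min_le_left _ _)
  set z : (Fin k → Bool) → Fin k → ℝ := fun b i => w i * ytov k b i with hz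
  have hz1 : ∀ b i, -1 ≤ z b i := by
    intro b i
    have := hw1 i
    have := hw2 i
    simp only [hz, ytov]
    split_ifs <;> linarith
  have hz2 : ∀ b i, z b i ≤ 1 := by
    intro b i
    have := hw1 i
    have := hw2 i
    simp only [hz, ytov]
    split_ifs <;> linarith
  have hclip : ∀ b i, 1 - z b i ≤ max (1 - u i * ytov k b i) 0 := by
    intro b i
    simp only [hz, hw, ytov]
    split_ifs <;> grind
  set σ : (Fin k → Bool) → Equiv.Perm (Fin k) := fun b => Tuple.sort (z b)
  have hσ : ∀ b, Monotone (z b ∘ σ b) := fun b => Tuple.monotone_sort (z b)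
  set d : (Fin k → Bool) → Fin k → ℝ := fun b i =>
    f (Spi k (σ b) ((i : ℕ) + 1)) - f (Spi k (σ b) (i : ℕ)) with hd
  obtain ⟨t, ht⟩ := exists_sum_signThreshold_le (univ : Finset ((Fin k → Bool) × Fin k))
    (fun q => -(p (ytov k q.1) * d q.1 q.2)) (fun q => z q.1 (σ q.1 q.2))
    (fun q => hz1 _ _) (fun q => hz2 _ _)
  have hv : ∀ i, signThreshold t (w i) = -1 ∨ signThreshold t (w i) = 0 ∨
    signThreshold t (w i) = 1 := fun i => signThreshold_mem t (w i)
  have hexpand : ∀ g : ℝ → ℝ,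
      ∑ b, p (ytov k b) * lovaszSum k f (σ b) (fun i => 1 - g (z b i)) =
        ∑ b, p (ytov k b) * lovaszSum k f (σ b) (fun _ => 1) +
          ∑ q : (Fin k → Bool) × Fin k, -(p (ytov k q.1) * d q.1 q.2) * g (z q.1 (σ q.1 q.2)) := by
    intro g
    rw [Fintype.sum_prod_type, ← Finset.sum_add_distrib]
    refine Finset.sum_congr rfl fun b _ => ?_
    simp only [lovaszSum, Finset.mul_sum]
    rw [← Finset.sum_add_distrib]
    refine Finset.sum_congr rfl fun i _ => ?_
    simp only [hd]
    ring
  refine ⟨fun i => signThreshold t (w i), hv, ?_⟩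
  calc expLossAbs k f (fun i => signThreshold t (w i)) p
      = ∑ b, p (ytov k b) * lovaszSum k f (σ b) (fun i => 1 - signThreshold t (z b i)) := by
        refine Finset.sum_congr rfl fun b _ => ?_
        rw [← lovaszSum_one_sub_eq_labs hnorm hv b (σ b)]
        · simp only [signThreshold_mul_ytov, hz]
        · simp only [signThreshold_mul_ytov]
          exact (signThreshold_mono t).comp (hσ b)
    _ ≤ ∑ b, p (ytov k b) * lovaszSum k f (σ b) (fun i => 1 - z b i) := by
        rw [hexpand (signThreshold t), hexpand fun x => x]
        linarith
    _ ≤ expLossL k f u p :=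
        Finset.sum_le_sum fun b _ => mul_le_mul_of_nonneg_left
          ((lovaszSum_mono hinc (σ b) (hclip b)).trans (lovaszSum_le_lovaszExt f (σ b) _)) (hp b)

theorem labs_le_lovaszHinge {k : ℕ} {f : Finset (Fin k) → ℝ} (hnorm : f ∅ = 0)
    (hinc : ∀ S T : Finset (Fin k), Disjoint S T → f S ≤ f (S ∪ T))
    {v : Fin k → ℝ} (hv : ∀ i, v i = -1 ∨ v i = 0 ∨ v i = 1) (b : Fin k → Bool) :
    labs k f v (ytov k b) ≤ lovaszHinge k f v (ytov k b) := by
  rw [← lovaszSum_one_sub_eq_labs hnorm hv b (Tuple.sort fun i => v i * ytov k b i)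
    (Tuple.monotone_sort fun i => v i * ytov k b i)]
  exact (lovaszSum_mono hinc _ fun i => le_max_left _ _).trans (lovaszSum_le_lovaszExt f _ _)

theorem expLossL_eq_expLossAbs {k : ℕ} {f : Finset (Fin k) → ℝ}
    (hsub : ∀ S T : Finset (Fin k), f (S ∪ T) + f (S ∩ T) ≤ f S + f T)
    (hinc : ∀ S T : Finset (Fin k), Disjoint S T → f S ≤ f (S ∪ T)) (hnorm : f ∅ = 0)
    (p : (Fin k → ℝ) → ℝ) {v : Fin k → ℝ} (hv : ∀ i, v i = -1 ∨ v i = 0 ∨ v i = 1) :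
    expLossL k f v p = expLossAbs k f v p :=
  Finset.sum_congr rfl fun b _ => congrArg _
    ((lovaszHinge_le_labs hsub hnorm hv b).antisymm (labs_le_lovaszHinge hnorm hinc hv b))

/-- the Lovász hinge embeds the structured abstain loss:
`v ∈ V` minimizes `ℓ_abs^f(·; p)` over `V` iff it minimizes `L^f(·; p)` over `ℝ^k`. -/
theorem stmt6 (k : ℕ) (hk : 1 ≤ k) (f : Finset (Fin k) → ℝ)
    (hsub : ∀ S T : Finset (Fin k), f (S ∪ T) + f (S ∩ T) ≤ f S + f T)
    (hinc : ∀ S T : Finset (Fin k), Disjoint S T → f S ≤ f (S ∪ T))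
    (hnorm : f ∅ = 0)
    (p : (Fin k → ℝ) → ℝ) (hp : IsProb k p)
    (v : Fin k → ℝ) (hv : ∀ i, v i = -1 ∨ v i = 0 ∨ v i = 1) :
    (∀ v' : Fin k → ℝ, (∀ i, v' i = -1 ∨ v' i = 0 ∨ v' i = 1) →
        expLossAbs k f v p ≤ expLossAbs k f v' p)
      ↔ (∀ u : Fin k → ℝ, expLossL k f v p ≤ expLossL k f u p) := by
  constructor
  · intro h u
    obtain ⟨v', hv', hle⟩ := exists_expLossAbs_le_expLossL hinc hnorm hp.1 u
    exact (expLossL_eq_expLossAbs hsub hinc hnorm p hv).trans_le ((h v' hv').trans hle)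
  · intro h v' hv'
    rw [← expLossL_eq_expLossAbs hsub hinc hnorm p hv,
      ← expLossL_eq_expLossAbs hsub hinc hnorm p hv']
    exact h v'
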